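/- For any b ∈ B_n, any bounded measurable function φ on X × X, and all N ≥ 1: E[μ_b^N(φ)] = μ_b(φ). -/

import Mathlib

open MeasureTheory ProbabilityTheory Filter
open scoped ENNReal NNReal Classical

noncomputable section

namespace PFVar

variable {X : Type*} [MeasurableSpace X]

/-- The unnormalized Feynman–Kac measures `γ_p`. -/
def gammaFK (M0 : Measure X) (M : ℕ → Kernel X X) (G : ℕ → X → ℝ) : ℕ → Measure X
  | 0 => M0
  | p + 1 =>
      ((gammaFK M0 M G p).withDensity fun x => ENNReal.ofReal (G p x)).bind
        (fun x => M (p + 1) x)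

/-- `γ_n(φ)`. -/
def gInt (M0 : Measure X) (M : ℕ → Kernel X X) (G : ℕ → X → ℝ) (n : ℕ) (φ : X → ℝ) : ℝ :=
  ∫ x, φ x ∂(gammaFK M0 M G n)

/-- `η_n(φ) = γ_n(φ)/γ_n(1)`. -/
def eInt (M0 : Measure X) (M : ℕ → Kernel X X) (G : ℕ → X → ℝ) (n : ℕ) (φ : X → ℝ) : ℝ :=
  gInt M0 M G n φ / gInt M0 M G n 1

/-- Law of the path `(X_0,…,X_k)` of an inhomogeneous Markov chain with initial law `μ0` and
transitions `κ`, recorded as an element of `ℕ → Y` (coordinates beyond `k` are junk). -/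
def markovPath {Y : Type*} [MeasurableSpace Y] (μ0 : Measure Y) (κ : ℕ → Y → Measure Y) :
    ℕ → Measure (ℕ → Y)
  | 0 => μ0.map fun y _ => y
  | k + 1 =>
      (markovPath μ0 κ k).bind fun ω =>
        (κ (k + 1) (ω k)).map fun y => Function.update ω (k + 1) y

/-- Categorical distribution on `{0,…,m−1} ⊆ ℕ` with weights `w`. -/
def cat (m : ℕ) (w : ℕ → ℝ) : Measure ℕ :=
  (∑ j ∈ Finset.range m, ENNReal.ofReal (w j))⁻¹ •
    ∑ j ∈ Finset.range m, ENNReal.ofReal (w j) • Measure.dirac j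

/-- Uniform distribution on `{0,…,m−1}`. -/
def unif (m : ℕ) : Measure ℕ := cat m fun _ => 1

/-- Extend a finite tuple to `ℕ` with junk values. -/
def padF {Y : Type*} [Nonempty Y] {m : ℕ} (f : Fin m → Y) : ℕ → Y := fun i =>
  if h : i < m then f ⟨i, h⟩ else Classical.arbitrary Y

/-- One resampling/mutation step of the particle filter: given the time-`p` configuration `z`,
the joint law of the ancestor indices `A_p` and the time-`p+1` particle configuration;
each of the `Np (p+1)` new particles independently draws an ancestor from the categorical
distribution with weights `G p (z j)`, `j < Np p`, and then moves according to `M (p+1)`. -/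
def pfStep [Nonempty X] (M : ℕ → Kernel X X) (G : ℕ → X → ℝ) (Np : ℕ → ℕ) (p : ℕ)
    (z : ℕ → X) : Measure ((ℕ → ℕ) × (ℕ → X)) :=
  (Measure.pi fun _ : Fin (Np (p + 1)) =>
      (cat (Np p) fun j => G p (z j)).bind fun a =>
        (M (p + 1) (z a)).map fun x => (a, x)).map fun f =>
    (padF fun i => (f i).1, padF fun i => (f i).2)

/-- The law of the particle system `(ζ, A)` run up to time `k`: the first component is
`ζ : time → particle index → X`, the second is `A : time → particle index → ℕ`, where
`A p i` is the ancestor index of particle `i` of generation `p+1`. -/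
def pfLaw [Nonempty X] (M0 : Measure X) (M : ℕ → Kernel X X) (G : ℕ → X → ℝ)
    (Np : ℕ → ℕ) : ℕ → Measure ((ℕ → ℕ → X) × (ℕ → ℕ → ℕ))
  | 0 =>
      (Measure.pi fun _ : Fin (Np 0) => M0).map fun f =>
        (fun p => if p = 0 then padF f else fun _ => Classical.arbitrary X, fun _ _ => 0)
  | k + 1 =>
      (pfLaw M0 M G Np k).bind fun ω =>
        (pfStep M G Np k (ω.1 k)).map fun az =>
          (Function.update ω.1 (k + 1) az.2, Function.update ω.2 k az.1)

/-- Eve indices: `eve A 0 i = i` and `eve A (p+1) i = eve A p (A p i)`. -/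
def eve (A : ℕ → ℕ → ℕ) : ℕ → ℕ → ℕ
  | 0 => fun i => i
  | p + 1 => fun i => eve A p (A p i)

/-- `η_n^N(φ)`. -/
def etaN (Np : ℕ → ℕ) (n : ℕ) (φ : X → ℝ) (ω : (ℕ → ℕ → X) × (ℕ → ℕ → ℕ)) : ℝ :=
  (Np n : ℝ)⁻¹ * ∑ i ∈ Finset.range (Np n), φ (ω.1 n i)

/-- `γ_n^N(φ)`. -/
def gammaN (G : ℕ → X → ℝ) (Np : ℕ → ℕ) (n : ℕ) (φ : X → ℝ)
    (ω : (ℕ → ℕ → X) × (ℕ → ℕ → ℕ)) : ℝ :=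
  (∏ p ∈ Finset.range n, etaN Np p (G p) ω) * etaN Np n φ ω

/-- The variance estimator `V_n^N(φ)`. -/
def Vest (Np : ℕ → ℕ) (n : ℕ) (φ : X → ℝ) (ω : (ℕ → ℕ → X) × (ℕ → ℕ → ℕ)) : ℝ :=
  etaN Np n φ ω ^ 2 -
    (∏ p ∈ Finset.range n, (Np p : ℝ) / ((Np p : ℝ) - 1)) *
      ((Np n : ℝ) * ((Np n : ℝ) - 1))⁻¹ *
      ∑ i ∈ Finset.range (Np n), ∑ j ∈ Finset.range (Np n),
        if eve ω.2 n i ≠ eve ω.2 n j then φ (ω.1 n i) * φ (ω.1 n j) else 0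

/-- Initial law of the doubled chain used to define `μ_b`. -/
def pairInit (M0 : Measure X) (b : ℕ → Bool) : Measure (X × X) :=
  if b 0 then M0.map fun x => (x, x) else M0.prod M0

/-- Transitions of the doubled chain used to define `μ_b`. -/
def pairKer (M : ℕ → Kernel X X) (b : ℕ → Bool) (p : ℕ) (q : X × X) : Measure (X × X) :=
  if b p then (M p q.1).map fun y => (y, y) else (M p q.1).prod (M p q.2)

/-- `μ_b(φ) = E_b[φ(X_n, X_n') ∏_{p<n} G_p(X_p) G_p(X_p')]`. -/
def muB (M0 : Measure X) (M : ℕ → Kernel X X) (G : ℕ → X → ℝ) (n : ℕ) (b : ℕ → Bool)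
    (φ : X × X → ℝ) : ℝ :=
  ∫ ω, φ (ω n) * ∏ p ∈ Finset.range n, G p (ω p).1 * G p (ω p).2
    ∂(markovPath (pairInit M0 b) (pairKer M b) n)

/-- `φ ⊗ φ`. -/
def tens (φ : X → ℝ) : X × X → ℝ := fun q => φ q.1 * φ q.2

/-- The binary string `e_p`. -/
def eVec (p : ℕ) : ℕ → Bool := fun q => q == p

/-- The zero binary string `0_n`. -/
def zeroVec : ℕ → Bool := fun _ => false

/-- Extension of a finite binary string to `ℕ → Bool`. -/
def extB (n : ℕ) (b : Fin (n + 1) → Bool) : ℕ → Bool := fun p =>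
  if h : p < n + 1 then b ⟨p, h⟩ else false

/-- `v_{p,n}(φ) = (μ_{e_p}(φ⊗φ) − μ_{0_n}(φ⊗φ)) / γ_n(1)²`. -/
def vpn (M0 : Measure X) (M : ℕ → Kernel X X) (G : ℕ → X → ℝ) (n p : ℕ) (φ : X → ℝ) : ℝ :=
  (muB M0 M G n (eVec p) (tens φ) - muB M0 M G n zeroVec (tens φ)) / gInt M0 M G n 1 ^ 2

/-- `σ_n²(φ) = Σ_{p=0}^n c_p⁻¹ v_{p,n}(φ)`. -/
def sigma2 (M0 : Measure X) (M : ℕ → Kernel X X) (G : ℕ → X → ℝ) (c : ℕ → ℝ) (n : ℕ)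
    (φ : X → ℝ) : ℝ :=
  ∑ p ∈ Finset.range (n + 1), (c p)⁻¹ * vpn M0 M G n p φ

/-- Particle numbers `N_p = ⌈c_p N⌉`. -/
def npart (c : ℕ → ℝ) (N : ℕ) (p : ℕ) : ℕ := ⌈c p * (N : ℝ)⌉₊

/-- Backward tracing: `traceAux A n kn j = K_{n-j}` where `K_n = kn`, `K_p = A p (K_{p+1})`. -/
def traceAux (A : ℕ → ℕ → ℕ) (n kn : ℕ) : ℕ → ℕ
  | 0 => kn
  | j + 1 => A (n - (j + 1)) (traceAux A n kn j)

/-- The deterministic ancestral trace `K¹`: `trace A n kn p = K_p¹` given `K_n¹ = kn`. -/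
def trace (A : ℕ → ℕ → ℕ) (n kn : ℕ) : ℕ → ℕ := fun p => traceAux A n kn (n - p)

/-- Conditional law of the broken-lineage trace `(K_0²,…,K_p²)` given `K_p² = v`
(entries above `p` are junk, to be overwritten). -/
def k2Law (G : ℕ → X → ℝ) (Np : ℕ → ℕ) (ω : (ℕ → ℕ → X) × (ℕ → ℕ → ℕ)) (K1 : ℕ → ℕ) :
    ℕ → ℕ → Measure (ℕ → ℕ)
  | 0 => fun v => Measure.dirac fun q => if q = 0 then v else 0
  | p + 1 => fun v =>
      ((if v = K1 (p + 1) then cat (Np p) fun j => G p (ω.1 p j)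
          else Measure.dirac (ω.2 p v)).bind fun w =>
        (k2Law G Np ω K1 p w).map fun f => Function.update f (p + 1) v)

/-- Conditional law of `(K¹, K²)` given the particle system `ω = (ζ, A)`. -/
def kLaw (G : ℕ → X → ℝ) (Np : ℕ → ℕ) (n : ℕ) (ω : (ℕ → ℕ → X) × (ℕ → ℕ → ℕ)) :
    Measure ((ℕ → ℕ) × (ℕ → ℕ)) :=
  (unif (Np n)).bind fun k1n =>
    (unif (Np n)).bind fun k2n =>
      (k2Law G Np ω (trace ω.2 n k1n) n k2n).map fun k2 => (trace ω.2 n k1n, k2)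

/-- Joint law of the particle system together with the tracing variables `(K¹, K²)`. -/
def pfkLaw [Nonempty X] (M0 : Measure X) (M : ℕ → Kernel X X) (G : ℕ → X → ℝ)
    (Np : ℕ → ℕ) (n : ℕ) :
    Measure (((ℕ → ℕ → X) × (ℕ → ℕ → ℕ)) × ((ℕ → ℕ) × (ℕ → ℕ))) :=
  (pfLaw M0 M G Np n).bind fun ω => (kLaw G Np n ω).map fun k => (ω, k)

/-- `(k¹, k²) ∈ I(b)`. -/
def inI (Np : ℕ → ℕ) (n : ℕ) (b : ℕ → Bool) (k : (ℕ → ℕ) × (ℕ → ℕ)) : Prop :=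
  ∀ p ≤ n, k.1 p < Np p ∧ k.2 p < Np p ∧ (k.1 p = k.2 p ↔ b p = true)

/-- The particle approximation `μ_b^N(φ)` (a function of the realization `ω = (ζ, A)`);
the conditional expectation given `(A, ζ)` is the integral with respect to `kLaw`. -/
def muBN (G : ℕ → X → ℝ) (Np : ℕ → ℕ) (n : ℕ) (b : ℕ → Bool) (φ : X × X → ℝ)
    (ω : (ℕ → ℕ → X) × (ℕ → ℕ → ℕ)) : ℝ :=
  (∏ p ∈ Finset.range (n + 1),
      if b p then (Np p : ℝ) else (Np p : ℝ) / ((Np p : ℝ) - 1)) *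
    gammaN G Np n 1 ω ^ 2 *
    ∫ k, (if inI Np n b k then (1 : ℝ) else 0) * φ (ω.1 n (k.1 n), ω.1 n (k.2 n))
      ∂(kLaw G Np n ω)

/-- `v_{p,n}^N(φ)`. -/
def vpnN (G : ℕ → X → ℝ) (Np : ℕ → ℕ) (n p : ℕ) (φ : X → ℝ)
    (ω : (ℕ → ℕ → X) × (ℕ → ℕ → ℕ)) : ℝ :=
  (muBN G Np n (eVec p) (tens φ) ω - muBN G Np n zeroVec (tens φ) ω) / gammaN G Np n 1 ω ^ 2

/-- `v_n^N(φ) = Σ_{p=0}^n c_p⁻¹ v_{p,n}^N(φ)`. -/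
def vnN (G : ℕ → X → ℝ) (Np : ℕ → ℕ) (c : ℕ → ℝ) (n : ℕ) (φ : X → ℝ)
    (ω : (ℕ → ℕ → X) × (ℕ → ℕ → ℕ)) : ℝ :=
  ∑ p ∈ Finset.range (n + 1), (c p)⁻¹ * vpnN G Np n p φ ω

/-- `QAux M G n φ j = Q_{n-j,n}(φ)`. -/
def QAux (M : ℕ → Kernel X X) (G : ℕ → X → ℝ) (n : ℕ) (φ : X → ℝ) : ℕ → X → ℝ
  | 0 => φ
  | j + 1 => fun x => G (n - (j + 1)) x * ∫ y, QAux M G n φ j y ∂(M (n - j) x)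

/-- `Q_{p,n}(φ)` where `Q_p(x, dx') = G_{p-1}(x) M_p(x, dx')`, `Q_{n,n} = Id`,
`Q_{p,n} = Q_{p+1} ⋯ Q_n`. -/
def Qpn (M : ℕ → Kernel X X) (G : ℕ → X → ℝ) (n p : ℕ) (φ : X → ℝ) : X → ℝ :=
  QAux M G n φ (n - p)

/-- `φ̂ = G_n · φ`. -/
def hatf (G : ℕ → X → ℝ) (n : ℕ) (φ : X → ℝ) : X → ℝ := fun x => G n x * φ x

/-- `γ̂_n(φ) = γ_n(G_n φ)`. -/
def gHatInt (M0 : Measure X) (M : ℕ → Kernel X X) (G : ℕ → X → ℝ) (n : ℕ) (φ : X → ℝ) : ℝ :=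
  gInt M0 M G n (hatf G n φ)

/-- `η̂_n(φ) = γ̂_n(φ)/γ̂_n(1)`. -/
def eHatInt (M0 : Measure X) (M : ℕ → Kernel X X) (G : ℕ → X → ℝ) (n : ℕ) (φ : X → ℝ) : ℝ :=
  gHatInt M0 M G n φ / gHatInt M0 M G n 1

/-- `γ̂_n^N(φ) = γ_n^N(G_n φ)`. -/
def gammaHatN (G : ℕ → X → ℝ) (Np : ℕ → ℕ) (n : ℕ) (φ : X → ℝ)
    (ω : (ℕ → ℕ → X) × (ℕ → ℕ → ℕ)) : ℝ :=
  gammaN G Np n (hatf G n φ) ω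

/-- `η̂_n^N(φ) = γ̂_n^N(φ)/γ̂_n^N(1)`. -/
def etaHatN (G : ℕ → X → ℝ) (Np : ℕ → ℕ) (n : ℕ) (φ : X → ℝ)
    (ω : (ℕ → ℕ → X) × (ℕ → ℕ → ℕ)) : ℝ :=
  gammaHatN G Np n φ ω / gammaHatN G Np n 1 ω

/-- `v̂_{p,n}(φ) = v_{p,n}(φ̂)/η_n(G_n)²`. -/
def vpnHat (M0 : Measure X) (M : ℕ → Kernel X X) (G : ℕ → X → ℝ) (n p : ℕ) (φ : X → ℝ) : ℝ :=
  vpn M0 M G n p (hatf G n φ) / eInt M0 M G n (G n) ^ 2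

/-- `σ̂_n²(φ) = Σ_{p=0}^n c_p⁻¹ v̂_{p,n}(φ)`. -/
def sigma2Hat (M0 : Measure X) (M : ℕ → Kernel X X) (G : ℕ → X → ℝ) (c : ℕ → ℝ) (n : ℕ)
    (φ : X → ℝ) : ℝ :=
  ∑ p ∈ Finset.range (n + 1), (c p)⁻¹ * vpnHat M0 M G n p φ

/-- `V̂_n^N(φ) = V_n^N(φ̂)/η_n^N(G_n)²`. -/
def VestHat (G : ℕ → X → ℝ) (Np : ℕ → ℕ) (n : ℕ) (φ : X → ℝ)
    (ω : (ℕ → ℕ → X) × (ℕ → ℕ → ℕ)) : ℝ :=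
  Vest Np n (hatf G n φ) ω / etaN Np n (G n) ω ^ 2

/-- `v̂_{p,n}^N(φ) = v_{p,n}^N(φ̂)/η_n^N(G_n)²`. -/
def vpnHatN (G : ℕ → X → ℝ) (Np : ℕ → ℕ) (n p : ℕ) (φ : X → ℝ)
    (ω : (ℕ → ℕ → X) × (ℕ → ℕ → ℕ)) : ℝ :=
  vpnN G Np n p (hatf G n φ) ω / etaN Np n (G n) ω ^ 2

/-- `v̂_n^N(φ) = Σ_{p=0}^n c_p⁻¹ v̂_{p,n}^N(φ)`. -/
def vnHatN (G : ℕ → X → ℝ) (Np : ℕ → ℕ) (c : ℕ → ℝ) (n : ℕ) (φ : X → ℝ)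
    (ω : (ℕ → ℕ → X) × (ℕ → ℕ → ℕ)) : ℝ :=
  ∑ p ∈ Finset.range (n + 1), (c p)⁻¹ * vpnHatN G Np n p φ ω

section General

variable {Y Z Ω : Type*} [MeasurableSpace Y] [MeasurableSpace Z] [MeasurableSpace Ω]

theorem integrable_of_bounded {μ : Measure Y} [IsFiniteMeasure μ] {g : Y → ℝ}
    (hg : Measurable g) (hb : ∃ C, ∀ y, |g y| ≤ C) : Integrable g μ := by
  obtain ⟨C, hC⟩ := hb
  exact Integrable.of_bound hg.aestronglyMeasurable C (Eventually.of_forall hC)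

theorem bounded_mul {S : Type*} {g h : S → ℝ} (hg : ∃ C, ∀ y, |g y| ≤ C) (hh : ∃ C, ∀ y, |h y| ≤ C) :
    ∃ C, ∀ y, |g y * h y| ≤ C := by
  obtain ⟨C, hC⟩ := hg
  obtain ⟨D, hD⟩ := hh
  refine ⟨C * D, fun y => ?_⟩
  rw [abs_mul]
  exact mul_le_mul (hC y) (hD y) (abs_nonneg _) ((abs_nonneg _).trans (hC y))

theorem bounded_sum {S : Type*} {ι : Type*} (s : Finset ι) {g : ι → S → ℝ}
    (hg : ∀ i ∈ s, ∃ C, ∀ y, |g i y| ≤ C) : ∃ C, ∀ y, |∑ i ∈ s, g i y| ≤ C := by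
  choose! C hC using hg
  exact ⟨∑ i ∈ s, C i, fun y =>
    (Finset.abs_sum_le_sum_abs _ _).trans (Finset.sum_le_sum fun i hi => hC i hi y)⟩

theorem bounded_prod {S : Type*} {ι : Type*} (s : Finset ι) {g : ι → S → ℝ}
    (hg : ∀ i ∈ s, ∃ C, ∀ y, |g i y| ≤ C) : ∃ C, ∀ y, |∏ i ∈ s, g i y| ≤ C := by
  choose! C hC using hg
  refine ⟨∏ i ∈ s, C i, fun y => ?_⟩
  rw [Finset.abs_prod]
  exact Finset.prod_le_prod (fun i _ => abs_nonneg _) fun i hi => hC i hi y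

theorem bounded_integral {S : Type*} {κ : S → Measure Y} [∀ ω, IsProbabilityMeasure (κ ω)]
    {g : Y → ℝ} (hb : ∃ C, ∀ y, |g y| ≤ C) : ∃ C, ∀ ω, |∫ y, g y ∂(κ ω)| ≤ C := by
  obtain ⟨C, hC⟩ := hb
  refine ⟨C, fun ω => ?_⟩
  have := norm_integral_le_of_norm_le_const (μ := κ ω) (f := g) (C := C) (Eventually.of_forall hC)
  simpa using this

theorem integral_bind_of_bounded {μ : Measure Ω} [IsFiniteMeasure μ] {κ : Ω → Measure Y}
    [∀ ω, IsProbabilityMeasure (κ ω)] (hκ : Measurable κ) {g : Y → ℝ}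
    (hg : Measurable g) (hb : ∃ C, ∀ y, |g y| ≤ C) :
    ∫ y, g y ∂(μ.bind κ) = ∫ ω, ∫ y, g y ∂(κ ω) ∂μ := by
  let η : Kernel Ω Y := ⟨κ, hκ⟩
  have : IsMarkovKernel η := ⟨fun ω => inferInstanceAs (IsProbabilityMeasure (κ ω))⟩
  have h := Kernel.integral_comp (κ := Kernel.const Unit μ) (η := η) (a := ()) (f := g)
    (integrable_of_bounded hg hb)
  rw [Kernel.comp_apply, Kernel.const_apply] at h
  exact h

theorem measurable_map_of_measurable_uncurry {κ : Ω → Measure Z}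
    [∀ ω, IsProbabilityMeasure (κ ω)] (hκ : Measurable κ) {Φ : Ω → Z → Y}
    (hΦ : Measurable (Function.uncurry Φ)) : Measurable fun ω => (κ ω).map (Φ ω) := by
  let η : Kernel Ω Z := ⟨κ, hκ⟩
  have : IsMarkovKernel η := ⟨fun ω => inferInstanceAs (IsProbabilityMeasure (κ ω))⟩
  refine Measure.measurable_of_measurable_coe _ fun s hs => ?_
  have h := Kernel.measurable_kernel_prodMk_left (κ := η) (hΦ hs)
  convert h using 2 with ω
  rw [Measure.map_apply hΦ.of_uncurry_left hs]
  rfl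

theorem integral_bind_map {μ : Measure Ω} [IsFiniteMeasure μ] {κ : Ω → Measure Z}
    [∀ ω, IsProbabilityMeasure (κ ω)] (hκ : Measurable κ) {Φ : Ω → Z → Y}
    (hΦ : Measurable (Function.uncurry Φ)) {g : Y → ℝ}
    (hg : Measurable g) (hb : ∃ C, ∀ y, |g y| ≤ C) :
    ∫ y, g y ∂(μ.bind fun ω => (κ ω).map (Φ ω)) = ∫ ω, ∫ z, g (Φ ω z) ∂(κ ω) ∂μ := by
  have (ω : Ω) : IsProbabilityMeasure ((κ ω).map (Φ ω)) :=
    Measure.isProbabilityMeasure_map hΦ.of_uncurry_left.aemeasurable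
  rw [integral_bind_of_bounded (measurable_map_of_measurable_uncurry hκ hΦ) hg hb]
  congr 1 with ω
  exact integral_map hΦ.of_uncurry_left.aemeasurable hg.aestronglyMeasurable

theorem isProbabilityMeasure_bind_map {μ : Measure Ω} [IsProbabilityMeasure μ] {κ : Ω → Measure Z}
    [∀ ω, IsProbabilityMeasure (κ ω)] (hκ : Measurable κ) {Φ : Ω → Z → Y}
    (hΦ : Measurable (Function.uncurry Φ)) :
    IsProbabilityMeasure (μ.bind fun ω => (κ ω).map (Φ ω)) := by
  have (ω : Ω) : IsProbabilityMeasure ((κ ω).map (Φ ω)) :=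
    Measure.isProbabilityMeasure_map hΦ.of_uncurry_left.aemeasurable
  exact isProbabilityMeasure_bind (measurable_map_of_measurable_uncurry hκ hΦ).aemeasurable
    (Eventually.of_forall this)

theorem measurable_pi_const (N : ℕ) {ν : Ω → Measure Y} [∀ ω, IsProbabilityMeasure (ν ω)]
    (hν : Measurable ν) : Measurable fun ω => Measure.pi fun _ : Fin N => ν ω := by
  refine Measurable.measure_of_isPiSystem_of_isProbabilityMeasure generateFrom_pi.symm
    isPiSystem_pi ?_
  rintro _ ⟨s, hs, rfl⟩
  simp_rw [Measure.pi_pi]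
  exact Finset.measurable_prod _ fun i _ => (Measure.measurable_coe (hs i trivial)).comp hν

theorem map_pi_pair {N : ℕ} (ν : Measure Y) [IsProbabilityMeasure ν] {i j : Fin N} (hij : i ≠ j) :
    (Measure.pi fun _ : Fin N => ν).map (fun f => (f i, f j)) = ν.prod ν := by
  have h := (iIndepFun_pi (μ := fun _ : Fin N => ν) (X := fun _ => id)
    (fun _ => aemeasurable_id)).indepFun hij
  have h' := (indepFun_iff_map_prod_eq_prod_map_map (measurable_pi_apply i).aemeasurable
    (measurable_pi_apply j).aemeasurable).1 h
  rw [h', (measurePreserving_eval _ i).map_eq, (measurePreserving_eval _ j).map_eq]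

/-- Law of a pair of draws from `ν` that is coupled identically or drawn independently. -/
def pairMeasure (β : Bool) (ν : Measure Y) : Measure (Y × Y) :=
  if β then ν.map fun y => (y, y) else ν.prod ν

theorem integral_pi_sum_pairs {N : ℕ} (hN : 2 ≤ N) (β : Bool) (ν : Measure Y)
    [IsProbabilityMeasure ν] {g : Y × Y → ℝ} (hg : Measurable g) (hb : ∃ C, ∀ y, |g y| ≤ C) :
    (if β then (N : ℝ) else (N : ℝ) / ((N : ℝ) - 1)) * ((N : ℝ) ^ 2)⁻¹ *
      ∫ f, ∑ i : Fin N, ∑ j : Fin N, (if (i = j ↔ β = true) then g (f i, f j) else 0)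
        ∂(Measure.pi fun _ : Fin N => ν) = ∫ y, g y ∂(pairMeasure β ν) := by
  have hN' : (2 : ℝ) ≤ N := by exact_mod_cast hN
  have hterm (i j : Fin N) :
      ∫ f, (if (i = j ↔ β = true) then g (f i, f j) else 0) ∂(Measure.pi fun _ : Fin N => ν) =
        if (i = j ↔ β = true) then ∫ y, g y ∂(pairMeasure β ν) else 0 := by
    split_ifs with h
    · by_cases hij : i = j
      · have hβ := h.1 hij
        subst hij
        rw [pairMeasure, if_pos hβ, integral_map (by fun_prop) hg.aestronglyMeasurable]
        conv_rhs => rw [← (measurePreserving_eval (fun _ : Fin N => ν) i).map_eq]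
        have hd : Measurable fun y => g (y, y) := hg.comp (measurable_id.prodMk measurable_id)
        exact (integral_map (μ := Measure.pi fun _ : Fin N => ν) (φ := Function.eval i)
          (measurable_pi_apply i).aemeasurable hd.aestronglyMeasurable).symm
      · have hβ : ¬ β = true := fun h' => hij (h.2 h')
        rw [pairMeasure, if_neg hβ, ← map_pi_pair ν hij,
          integral_map (by fun_prop) hg.aestronglyMeasurable]
    · simp
  have hint (i j : Fin N) :
      Integrable (fun f : Fin N → Y => if (i = j ↔ β = true) then g (f i, f j) else 0)
        (Measure.pi fun _ : Fin N => ν) := by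
    split_ifs
    · obtain ⟨C, hC⟩ := hb
      exact integrable_of_bounded (by fun_prop) ⟨C, fun f => hC _⟩
    · exact integrable_zero _ _ _
  rw [integral_finsetSum _ fun i _ => integrable_finsetSum _ fun j _ => hint i j]
  simp_rw [integral_finsetSum _ fun j _ => hint _ j, hterm]
  cases β
  · have h1 (i : Fin N) : (∑ j : Fin N, if (i = j ↔ false = true) then
        ∫ y, g y ∂(pairMeasure false ν) else 0) =
          ((N : ℝ) - 1) * ∫ y, g y ∂(pairMeasure false ν) := by
      have h2 (j : Fin N) : (if (i = j ↔ false = true) then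
        ∫ y, g y ∂(pairMeasure false ν) else 0) = (∫ y, g y ∂(pairMeasure false ν)) -
          if i = j then ∫ y, g y ∂(pairMeasure false ν) else 0 := by
        by_cases h : i = j <;> simp [h]
      simp_rw [h2]
      rw [Finset.sum_sub_distrib, Finset.sum_ite_eq]
      simp
      ring
    simp_rw [h1]
    have : (N : ℝ) - 1 ≠ 0 := by linarith
    simp
    field_simp
  · have : (N : ℝ) ≠ 0 := by linarith
    simp
    field_simp

end General

theorem lintegral_cat (m : ℕ) (w : ℕ → ℝ) (f : ℕ → ℝ≥0∞) :
    ∫⁻ a, f a ∂(cat m w) = (∑ j ∈ Finset.range m, ENNReal.ofReal (w j))⁻¹ *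
      ∑ j ∈ Finset.range m, ENNReal.ofReal (w j) * f j := by
  simp [cat, lintegral_smul_measure, lintegral_finsetSum_measure, lintegral_dirac]

theorem integral_cat (m : ℕ) {w : ℕ → ℝ} (hw : ∀ j, 0 ≤ w j) (f : ℕ → ℝ) :
    ∫ a, f a ∂(cat m w) =
      ∑ j ∈ Finset.range m, w j / (∑ u ∈ Finset.range m, w u) * f j := by
  rw [cat, integral_smul_measure, integral_finsetSum_measure, ← ENNReal.ofReal_sum_of_nonneg
    (fun j _ => hw j), ENNReal.toReal_inv, ENNReal.toReal_ofReal (Finset.sum_nonneg fun j _ => hw j),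
    smul_eq_mul, Finset.mul_sum]
  · refine Finset.sum_congr rfl fun j _ => ?_
    rw [integral_smul_measure, integral_dirac, ENNReal.toReal_ofReal (hw j), smul_eq_mul]
    ring
  · exact fun j _ => (integrable_dirac (by simp)).smul_measure ENNReal.ofReal_ne_top

theorem isProbabilityMeasure_cat {m : ℕ} (hm : 0 < m) {w : ℕ → ℝ} (hw : ∀ j, 0 < w j) :
    IsProbabilityMeasure (cat m w) := by
  constructor
  have h := lintegral_cat m w fun _ => 1
  rw [lintegral_one] at h
  simp only [mul_one] at h
  rw [h, ENNReal.inv_mul_cancel]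
  · rw [← ENNReal.ofReal_sum_of_nonneg fun j _ => (hw j).le, ne_eq, ENNReal.ofReal_eq_zero, not_le]
    exact Finset.sum_pos (fun j _ => hw j) ⟨0, Finset.mem_range.2 hm⟩
  · exact ENNReal.sum_ne_top.2 fun _ _ => ENNReal.ofReal_ne_top

/-- Weight of an ancestor pair `(v, w)`: when `β` holds the second ancestor is redrawn from the
categorical distribution with weights `g`. -/
def ancestorWeight (β : Bool) (m : ℕ) (g : ℕ → ℝ) (F : ℕ → ℕ → ℝ) (v w : ℕ) : ℝ :=
  if β then ∑ u ∈ Finset.range m, g u / (∑ u' ∈ Finset.range m, g u') * F v u else F v w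

/-- Conditional probability, given the particle system and `(K_p¹, K_p²) = (i, j)`, that the
pair of lineages matches `b` up to time `p`. -/
def pairWeight (G : ℕ → X → ℝ) (Np : ℕ → ℕ) (b : ℕ → Bool)
    (ω : (ℕ → ℕ → X) × (ℕ → ℕ → ℕ)) : ℕ → ℕ → ℕ → ℝ
  | 0 => fun i j => if i < Np 0 ∧ j < Np 0 ∧ (i = j ↔ b 0 = true) then 1 else 0
  | p + 1 => fun i j =>
      if i < Np (p + 1) ∧ j < Np (p + 1) ∧ (i = j ↔ b (p + 1) = true) then
        ancestorWeight (b (p + 1)) (Np p) (fun u => G p (ω.1 p u)) (pairWeight G Np b ω p)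
          (ω.2 p i) (ω.2 p j)
      else 0

theorem inI_succ_update (Np : ℕ → ℕ) (b : ℕ → Bool) (K1 f : ℕ → ℕ) (p v : ℕ) :
    inI Np (p + 1) b (K1, Function.update f (p + 1) v) ↔
      (K1 (p + 1) < Np (p + 1) ∧ v < Np (p + 1) ∧ (K1 (p + 1) = v ↔ b (p + 1) = true)) ∧
        inI Np p b (K1, f) := by
  constructor
  · intro h
    refine ⟨by simpa using h (p + 1) le_rfl, fun q hq => ?_⟩
    have hne : q ≠ p + 1 := by omega
    simpa [hne] using h q (by omega)
  · rintro ⟨h1, h2⟩ q hq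
    rcases eq_or_ne q (p + 1) with rfl | hne
    · simpa using h1
    · simpa [hne] using h2 q (by omega)

theorem measurableSet_inI (Np : ℕ → ℕ) (n : ℕ) (b : ℕ → Bool) :
    MeasurableSet {k : (ℕ → ℕ) × (ℕ → ℕ) | inI Np n b k} := by
  simp only [inI]
  measurability

theorem measurable_inI_mul (Np : ℕ → ℕ) (n : ℕ) (b : ℕ → Bool) (h : ℕ → ℕ → ℝ) :
    Measurable fun k : (ℕ → ℕ) × (ℕ → ℕ) =>
      (if inI Np n b k then (1 : ℝ) else 0) * h (k.1 n) (k.2 n) := by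
  have h' : Measurable (Function.uncurry h) := measurable_of_countable _
  refine (Measurable.ite (measurableSet_inI Np n b) measurable_const measurable_const).mul ?_
  exact h'.comp (Measurable.prodMk (by fun_prop) (by fun_prop))

theorem bounded_ite_one_mul {S : Type*} (P : S → Prop) {h : S → ℝ} (hb : ∃ C, ∀ s, |h s| ≤ C) :
    ∃ C, ∀ s, |(if P s then (1 : ℝ) else 0) * h s| ≤ C := by
  refine bounded_mul ⟨1, fun s => ?_⟩ hb
  split_ifs <;> simp

omit [MeasurableSpace X] in
theorem isProbabilityMeasure_k2Law {G : ℕ → X → ℝ} {Np : ℕ → ℕ}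
    (ω : (ℕ → ℕ → X) × (ℕ → ℕ → ℕ)) (K1 : ℕ → ℕ) (p : ℕ)
    (hG : ∀ q < p, ∀ x, 0 < G q x) (hN : ∀ q < p, 0 < Np q) (v : ℕ) :
    IsProbabilityMeasure (k2Law G Np ω K1 p v) := by
  induction p generalizing v with
  | zero => simp only [k2Law]; infer_instance
  | succ p ih =>
    have := ih (fun q hq => hG q (by omega)) fun q hq => hN q (by omega)
    have hc : IsProbabilityMeasure (if v = K1 (p + 1) then cat (Np p) fun j => G p (ω.1 p j)
          else Measure.dirac (ω.2 p v)) := by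
      split_ifs
      · exact isProbabilityMeasure_cat (hN p (by omega)) fun j => hG p (by omega) _
      · infer_instance
    exact isProbabilityMeasure_bind_map (measurable_of_countable _)
      (measurable_from_prod_countable_right fun w => by
        simp only [Function.uncurry]; fun_prop)

theorem integral_k2Law {G : ℕ → X → ℝ} {Np : ℕ → ℕ} (b : ℕ → Bool)
    (ω : (ℕ → ℕ → X) × (ℕ → ℕ → ℕ)) (K1 : ℕ → ℕ) (p : ℕ)
    (hG : ∀ q < p, ∀ x, 0 < G q x) (hN : ∀ q < p, 0 < Np q)
    (hK : ∀ q < p, K1 q = ω.2 q (K1 (q + 1))) {h : ℕ → ℝ} (hh : ∃ C, ∀ i, |h i| ≤ C) (v : ℕ) :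
    ∫ f, (if inI Np p b (K1, f) then (1 : ℝ) else 0) * h (f p) ∂(k2Law G Np ω K1 p v) =
      pairWeight G Np b ω p (K1 p) v * h v := by
  induction p generalizing v h with
  | zero =>
    simp only [k2Law, pairWeight]
    rw [integral_dirac]
    simp [inI]
  | succ p ih =>
    have hG' : ∀ q < p, ∀ x, 0 < G q x := fun q hq => hG q (by omega)
    have hN' : ∀ q < p, 0 < Np q := fun q hq => hN q (by omega)
    have hk (w : ℕ) := isProbabilityMeasure_k2Law ω K1 p hG' hN' w
    have hc : IsProbabilityMeasure (if v = K1 (p + 1) then cat (Np p) fun j => G p (ω.1 p j)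
          else Measure.dirac (ω.2 p v)) := by
      split_ifs
      · exact isProbabilityMeasure_cat (hN p (by omega)) fun j => hG p (by omega) _
      · infer_instance
    have hm : Measurable fun f : ℕ → ℕ =>
        (if inI Np (p + 1) b (K1, f) then (1 : ℝ) else 0) * h (f (p + 1)) :=
      (measurable_inI_mul Np (p + 1) b fun _ j => h j).comp measurable_prodMk_left
    have hb : ∃ C, ∀ f : ℕ → ℕ,
        |(if inI Np (p + 1) b (K1, f) then (1 : ℝ) else 0) * h (f (p + 1))| ≤ C := by
      obtain ⟨C, hC⟩ := hh
      exact bounded_ite_one_mul _ ⟨C, fun f => hC _⟩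
    have ih1 (w : ℕ) := ih hG' hN' (fun q hq => hK q (by omega)) (h := fun _ => 1)
      ⟨1, by simp⟩ w
    simp only [mul_one] at ih1
    rw [k2Law, integral_bind_map (measurable_of_countable _)
      (measurable_from_prod_countable_right fun w => by
        simp only [Function.uncurry]; fun_prop) hm hb]
    simp only [inI_succ_update, Function.update_self]
    by_cases hcond : K1 (p + 1) < Np (p + 1) ∧ v < Np (p + 1) ∧ (K1 (p + 1) = v ↔ b (p + 1) = true)
    · simp only [hcond, true_and, integral_mul_const, ih1, pairWeight, if_true, ancestorWeight,
        and_self]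
      congr 1
      rw [hK p (by omega)]
      by_cases hv : v = K1 (p + 1)
      · rw [if_pos hv, if_pos (hcond.2.2.1 hv.symm)]
        exact integral_cat _ (fun j => (hG p (by omega) _).le) _
      · rw [if_neg hv, if_neg fun hb => hv (hcond.2.2.2 hb).symm, integral_dirac]
    · simp [hcond, pairWeight]

theorem trace_self (A : ℕ → ℕ → ℕ) (n k : ℕ) : trace A n k n = k := by
  simp [trace, traceAux]

theorem trace_of_lt (A : ℕ → ℕ → ℕ) {n p : ℕ} (k : ℕ) (hp : p < n) :
    trace A n k p = A p (trace A n k (p + 1)) := by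
  obtain ⟨d, rfl⟩ := Nat.exists_eq_add_of_lt hp
  have h1 : p + d + 1 - p = d + 1 := by omega
  have h2 : p + d + 1 - (p + 1) = d := by omega
  have h3 : p + d + 1 - (d + 1) = p := by omega
  rw [trace, trace, h1, h2, traceAux, h3]

/-- The normalizing constant in the definition of `μ_b^N`. -/
def pairConst (Np : ℕ → ℕ) (b : ℕ → Bool) (p : ℕ) : ℝ :=
  if b p then (Np p : ℝ) else (Np p : ℝ) / ((Np p : ℝ) - 1)

theorem muBN_eq {G : ℕ → X → ℝ} {Np : ℕ → ℕ} (n : ℕ) (b : ℕ → Bool)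
    (hG : ∀ q < n, ∀ x, 0 < G q x) (hN : ∀ q ≤ n, 0 < Np q)
    {φ : X × X → ℝ} (hφ : ∃ C, ∀ q, |φ q| ≤ C) (ω : (ℕ → ℕ → X) × (ℕ → ℕ → ℕ)) :
    muBN G Np n b φ ω = (∏ p ∈ Finset.range (n + 1), pairConst Np b p) *
      (∏ p ∈ Finset.range n, etaN Np p (G p) ω) ^ 2 * ((Np n : ℝ) ^ 2)⁻¹ *
        ∑ i ∈ Finset.range (Np n), ∑ j ∈ Finset.range (Np n),
          pairWeight G Np b ω n i j * φ (ω.1 n i, ω.1 n j) := by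
  have hNn : (Np n : ℝ) ≠ 0 := by exact_mod_cast (hN n le_rfl).ne'
  have hN' : ∀ q < n, 0 < Np q := fun q hq => hN q hq.le
  have hk (K1 : ℕ → ℕ) (v : ℕ) := isProbabilityMeasure_k2Law ω K1 n hG hN' v
  have hu : IsProbabilityMeasure (unif (Np n)) :=
    isProbabilityMeasure_cat (hN n le_rfl) fun _ => one_pos
  have huint (f : ℕ → ℝ) : ∫ a, f a ∂(unif (Np n)) =
      (Np n : ℝ)⁻¹ * ∑ j ∈ Finset.range (Np n), f j := by
    rw [unif, integral_cat _ (fun _ => zero_le_one), Finset.mul_sum]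
    simp
  have hm := measurable_inI_mul Np n b fun i j => φ (ω.1 n i, ω.1 n j)
  have hb : ∃ C, ∀ k : (ℕ → ℕ) × (ℕ → ℕ),
      |(if inI Np n b k then (1 : ℝ) else 0) * φ (ω.1 n (k.1 n), ω.1 n (k.2 n))| ≤ C := by
    obtain ⟨C, hC⟩ := hφ
    exact bounded_ite_one_mul _ ⟨C, fun f => hC _⟩
  have hΦ (i : ℕ) : Measurable (Function.uncurry fun (_ : ℕ) (k2 : ℕ → ℕ) =>
      (trace ω.2 n i, k2)) := by
    simp only [Function.uncurry_def]; fun_prop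
  have hp (i : ℕ) : IsProbabilityMeasure ((unif (Np n)).bind fun k2n =>
      (k2Law G Np ω (trace ω.2 n i) n k2n).map fun k2 => (trace ω.2 n i, k2)) :=
    isProbabilityMeasure_bind_map (measurable_of_countable _) (hΦ i)
  have hk2 (i j : ℕ) := integral_k2Law b ω (trace ω.2 n i) n hG hN'
    (fun q hq => trace_of_lt ω.2 i hq) (h := fun j => φ (ω.1 n i, ω.1 n j))
    (by obtain ⟨C, hC⟩ := hφ; exact ⟨C, fun j => hC _⟩) j
  have hK : ∫ k, (if inI Np n b k then (1 : ℝ) else 0) * φ (ω.1 n (k.1 n), ω.1 n (k.2 n))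
      ∂(kLaw G Np n ω) = ((Np n : ℝ) ^ 2)⁻¹ * ∑ i ∈ Finset.range (Np n),
        ∑ j ∈ Finset.range (Np n), pairWeight G Np b ω n i j * φ (ω.1 n i, ω.1 n j) := by
    rw [kLaw, integral_bind_of_bounded (measurable_of_countable _) hm hb, huint, pow_two,
      mul_inv, mul_assoc]
    congr 1
    rw [Finset.mul_sum]
    refine Finset.sum_congr rfl fun i _ => ?_
    rw [integral_bind_map (measurable_of_countable _) (hΦ i) hm hb, huint]
    congr 1
    refine Finset.sum_congr rfl fun j _ => ?_
    simp only [trace_self]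
    rw [hk2, trace_self]
  have hone : etaN Np n (1 : X → ℝ) ω = 1 := by
    simp [etaN, hNn]
  rw [muBN, hK, gammaN, hone, mul_one]
  simp only [pairConst]
  ring

theorem measurable_ancestorWeight {Ω : Type*} [MeasurableSpace Ω] (β : Bool) (m : ℕ)
    {g : Ω → ℕ → ℝ} (hg : ∀ j, Measurable fun ω => g ω j) {F : Ω → ℕ → ℕ → ℝ}
    (hF : ∀ i j, Measurable fun ω => F ω i j) (v w : ℕ) :
    Measurable fun ω => ancestorWeight β m (g ω) (F ω) v w := by
  simp only [ancestorWeight]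
  split_ifs <;> fun_prop

theorem abs_ancestorWeight_le_one (β : Bool) (m : ℕ) {g : ℕ → ℝ} (hg : ∀ j, 0 ≤ g j)
    {F : ℕ → ℕ → ℝ} (hF : ∀ i j, |F i j| ≤ 1) (v w : ℕ) :
    |ancestorWeight β m g F v w| ≤ 1 := by
  rw [ancestorWeight]
  split_ifs
  · have hS : 0 ≤ ∑ u ∈ Finset.range m, g u := Finset.sum_nonneg fun u _ => hg u
    refine (Finset.abs_sum_le_sum_abs _ _).trans (le_trans (Finset.sum_le_sum (g := fun u =>
      g u / ∑ u' ∈ Finset.range m, g u') fun u _ => ?_) ?_)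
    · rw [abs_mul, abs_of_nonneg (div_nonneg (hg u) hS)]
      exact mul_le_of_le_one_right (div_nonneg (hg u) hS) (hF v u)
    · rw [← Finset.sum_div]
      exact div_self_le_one _
  · exact hF v w

theorem measurable_pairWeight {G : ℕ → X → ℝ} (Np : ℕ → ℕ) (b : ℕ → Bool) (p : ℕ)
    (hG : ∀ q < p, Measurable (G q)) (i j : ℕ) :
    Measurable fun ω : (ℕ → ℕ → X) × (ℕ → ℕ → ℕ) => pairWeight G Np b ω p i j := by
  induction p generalizing i j with
  | zero => simp only [pairWeight]; exact measurable_const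
  | succ p ih =>
    simp only [pairWeight]
    refine Measurable.ite (by simp) ?_ measurable_const
    have ih := ih fun q hq => hG q (by omega)
    have hGp := hG p (by omega)
    have h (v w : ℕ) := measurable_ancestorWeight (b (p + 1)) (Np p)
      (g := fun (ω : (ℕ → ℕ → X) × (ℕ → ℕ → ℕ)) u => G p (ω.1 p u))
      (fun u => hGp.comp (by fun_prop)) (F := fun ω => pairWeight G Np b ω p) ih v w
    have h' : Measurable fun q : ((ℕ → ℕ → X) × (ℕ → ℕ → ℕ)) × (ℕ × ℕ) =>
        ancestorWeight (b (p + 1)) (Np p) (fun u => G p (q.1.1 p u)) (pairWeight G Np b q.1 p)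
          q.2.1 q.2.2 := measurable_from_prod_countable_left fun y => h y.1 y.2
    exact h'.comp (measurable_id.prodMk (Measurable.prodMk (by fun_prop) (by fun_prop)))

omit [MeasurableSpace X] in
theorem abs_pairWeight_le_one {G : ℕ → X → ℝ} (Np : ℕ → ℕ) (b : ℕ → Bool) (p : ℕ)
    (hG : ∀ q < p, ∀ x, 0 < G q x) (ω : (ℕ → ℕ → X) × (ℕ → ℕ → ℕ)) (i j : ℕ) :
    |pairWeight G Np b ω p i j| ≤ 1 := by
  induction p generalizing i j with
  | zero => simp only [pairWeight]; split_ifs <;> simp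
  | succ p ih =>
    simp only [pairWeight]
    split_ifs
    · exact abs_ancestorWeight_le_one _ _ (fun u => (hG p (by omega) _).le)
        (ih fun q hq => hG q (by omega)) _ _
    · simp

omit [MeasurableSpace X] in
theorem pairWeight_congr (G : ℕ → X → ℝ) (Np : ℕ → ℕ) (b : ℕ → Bool) (p : ℕ)
    {ω ω' : (ℕ → ℕ → X) × (ℕ → ℕ → ℕ)} (h : ∀ q < p, ω.1 q = ω'.1 q ∧ ω.2 q = ω'.2 q) :
    pairWeight G Np b ω p = pairWeight G Np b ω' p := by
  induction p with
  | zero => rfl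
  | succ p ih =>
    funext i j
    simp only [pairWeight, ih fun q hq => h q (by omega), h p (by omega)]

omit [MeasurableSpace X] in
theorem exists_abs_le_of_pos {G : X → ℝ} (hpos : ∀ x, 0 < G x) (hbd : ∃ C, ∀ x, G x ≤ C) :
    ∃ C, ∀ x, |G x| ≤ C := by
  obtain ⟨C, hC⟩ := hbd
  exact ⟨C, fun x => by rw [abs_of_pos (hpos x)]; exact hC x⟩

theorem measurable_muBN {G : ℕ → X → ℝ} {Np : ℕ → ℕ} (n : ℕ) (b : ℕ → Bool)
    (hG : ∀ q < n, ∀ x, 0 < G q x) (hGm : ∀ q < n, Measurable (G q)) (hN : ∀ q ≤ n, 0 < Np q)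
    {φ : X × X → ℝ} (hφm : Measurable φ) (hφ : ∃ C, ∀ q, |φ q| ≤ C) :
    Measurable (muBN G Np n b φ) := by
  rw [funext fun ω => muBN_eq n b hG hN hφ ω]
  have h1 := measurable_pairWeight (G := G) Np b n hGm
  have h2 : Measurable fun ω : (ℕ → ℕ → X) × (ℕ → ℕ → ℕ) =>
      ∏ p ∈ Finset.range n, etaN Np p (G p) ω := by
    refine Finset.measurable_prod _ fun p hp => ?_
    have := hGm p (Finset.mem_range.1 hp)
    unfold etaN
    fun_prop
  have h3 (i j : ℕ) : Measurable fun ω : (ℕ → ℕ → X) × (ℕ → ℕ → ℕ) =>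
      φ (ω.1 n i, ω.1 n j) := by fun_prop
  fun_prop

theorem bounded_muBN {G : ℕ → X → ℝ} {Np : ℕ → ℕ} (n : ℕ) (b : ℕ → Bool)
    (hG : ∀ q < n, ∀ x, 0 < G q x) (hGb : ∀ q < n, ∃ C, ∀ x, G q x ≤ C)
    (hN : ∀ q ≤ n, 0 < Np q) {φ : X × X → ℝ} (hφ : ∃ C, ∀ q, |φ q| ≤ C) :
    ∃ C, ∀ ω, |muBN G Np n b φ ω| ≤ C := by
  rw [funext fun ω => muBN_eq n b hG hN hφ ω]
  have hconst (c : ℝ) : ∃ C, ∀ _ : (ℕ → ℕ → X) × (ℕ → ℕ → ℕ), |c| ≤ C := ⟨|c|, fun _ => le_rfl⟩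
  have hprod : ∃ C, ∀ ω : (ℕ → ℕ → X) × (ℕ → ℕ → ℕ),
      |∏ p ∈ Finset.range n, etaN Np p (G p) ω| ≤ C := by
    refine bounded_prod _ fun p hp => ?_
    have hp := Finset.mem_range.1 hp
    obtain ⟨C, hC⟩ := exists_abs_le_of_pos (hG p hp) (hGb p hp)
    exact bounded_mul (hconst _) (bounded_sum _ fun i _ => ⟨C, fun ω => hC _⟩)
  simp only [pow_two (∏ p ∈ Finset.range n, _)]
  refine bounded_mul (bounded_mul (bounded_mul (hconst _) (bounded_mul hprod hprod)) (hconst _))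
    (bounded_sum _ fun i _ => bounded_sum _ fun j _ => bounded_mul
      ⟨1, fun ω => abs_pairWeight_le_one Np b n hG ω i j⟩ ?_)
  obtain ⟨C, hC⟩ := hφ
  exact ⟨C, fun ω => hC _⟩

/-- Joint law of the ancestor index and the new position of one particle. -/
def offspringLaw (K : Kernel X X) (g : X → ℝ) (m : ℕ) (z : ℕ → X) : Measure (ℕ × X) :=
  (cat m fun j => g (z j)).bind fun a => (K (z a)).map fun x => (a, x)

section Offspring

variable (K : Kernel X X) [IsMarkovKernel K] {g : X → ℝ} (hg : ∀ x, 0 < g x) {m : ℕ} (hm : 0 < m)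

include hg hm in
theorem isProbabilityMeasure_offspringLaw (z : ℕ → X) :
    IsProbabilityMeasure (offspringLaw K g m z) := by
  have := isProbabilityMeasure_cat hm fun j => hg (z j)
  exact isProbabilityMeasure_bind_map (κ := fun a => K (z a)) (measurable_of_countable _)
    (measurable_from_prod_countable_right fun w => by simp only [Function.uncurry]; fun_prop)

include hg hm in
theorem integral_offspringLaw (z : ℕ → X) {h : ℕ × X → ℝ} (hh : Measurable h)
    (hb : ∃ C, ∀ q, |h q| ≤ C) :
    ∫ q, h q ∂(offspringLaw K g m z) = ∑ j ∈ Finset.range m,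
      g (z j) / (∑ u ∈ Finset.range m, g (z u)) * ∫ x, h (j, x) ∂(K (z j)) := by
  have := isProbabilityMeasure_cat hm fun j => hg (z j)
  rw [offspringLaw, integral_bind_map (κ := fun a => K (z a)) (measurable_of_countable _)
    (measurable_from_prod_countable_right fun w => by simp only [Function.uncurry]; fun_prop) hh hb,
    integral_cat _ fun j => (hg _).le]

omit [IsMarkovKernel K] in
theorem measurable_offspringLaw (hgm : Measurable g) :
    Measurable (offspringLaw K g m) := by
  refine Measure.measurable_of_measurable_coe _ fun s hs => ?_
  simp only [offspringLaw]
  simp_rw [Measure.bind_apply hs (measurable_of_countable _).aemeasurable, lintegral_cat]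
  have h (j : ℕ) : Measurable fun z : ℕ → X => ((K (z j)).map fun x => (j, x)) s := by
    have : Measurable fun x : X => (j, x) := measurable_prodMk_left
    simp_rw [Measure.map_apply this hs]
    exact (K.measurable_coe (this hs)).comp (measurable_pi_apply j)
  fun_prop

include hg hm in
theorem integral_pairMeasure_offspringLaw (β : Bool) (z : ℕ → X) {F : ℕ → ℕ → ℝ}
    (hF : ∀ i j, |F i j| ≤ 1) {φ : X × X → ℝ} (hφm : Measurable φ) (hφ : ∃ C, ∀ q, |φ q| ≤ C) :
    ∫ q, ancestorWeight β m (fun u => g (z u)) F q.1.1 q.2.1 * φ (q.1.2, q.2.2)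
        ∂(pairMeasure β (offspringLaw K g m z)) =
      (∑ u ∈ Finset.range m, g (z u))⁻¹ ^ 2 * ∑ v ∈ Finset.range m, ∑ w ∈ Finset.range m,
        F v w * (g (z v) * g (z w) * ∫ q, φ q ∂(if β then (K (z v)).map fun y => (y, y)
          else (K (z v)).prod (K (z w)))) := by
  have := isProbabilityMeasure_offspringLaw K hg hm z
  have hφ' := hφ
  obtain ⟨C, hC⟩ := hφ'
  have hA : Measurable (Function.uncurry (ancestorWeight β m (fun u => g (z u)) F)) :=
    measurable_of_countable _
  have hm2 : Measurable fun q : (ℕ × X) × (ℕ × X) =>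
      ancestorWeight β m (fun u => g (z u)) F q.1.1 q.2.1 * φ (q.1.2, q.2.2) :=
    (hA.comp (Measurable.prodMk (f := fun q : (ℕ × X) × (ℕ × X) => q.1.1)
      (g := fun q => q.2.1) (by fun_prop) (by fun_prop))).mul (by fun_prop)
  have hb2 : ∃ C, ∀ q : (ℕ × X) × (ℕ × X),
      |ancestorWeight β m (fun u => g (z u)) F q.1.1 q.2.1 * φ (q.1.2, q.2.2)| ≤ C :=
    bounded_mul ⟨1, fun q => abs_ancestorWeight_le_one β m (fun u => (hg _).le) hF _ _⟩
      ⟨C, fun q => hC _⟩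
  obtain ⟨D, hD⟩ := hb2
  set S := ∑ u ∈ Finset.range m, g (z u) with hS
  cases β
  · simp only [pairMeasure, Bool.false_eq_true, if_false]
    rw [integral_prod _ (integrable_of_bounded hm2 ⟨D, hD⟩)]
    have hinner (q : ℕ × X) := integral_offspringLaw K hg hm z
      (hm2.comp (measurable_prodMk_left (x := q))) ⟨D, fun y => hD _⟩
    simp only [Function.comp_apply] at hinner
    simp_rw [hinner]
    have hmi (w : ℕ) : Measurable fun x => ∫ y, φ (x, y) ∂(K (z w)) :=
      hφm.stronglyMeasurable.integral_prod_right'.measurable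
    have hbi (w : ℕ) : ∃ C, ∀ x, |∫ y, φ (x, y) ∂(K (z w))| ≤ C := by
      refine ⟨C, fun x => ?_⟩
      have := norm_integral_le_of_norm_le_const (μ := K (z w)) (f := fun y => φ (x, y)) (C := C)
        (Eventually.of_forall fun y => hC _)
      simpa using this
    simp only [ancestorWeight, Bool.false_eq_true, if_false, integral_const_mul]
    rw [integral_offspringLaw K hg hm z]
    · rw [Finset.mul_sum]
      refine Finset.sum_congr rfl fun v _ => ?_
      simp only
      rw [integral_finsetSum _ fun w _ =>
        ((integrable_of_bounded (hmi w) (hbi w)).const_mul _).const_mul _, Finset.mul_sum,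
        Finset.mul_sum]
      refine Finset.sum_congr rfl fun w _ => ?_
      rw [integral_const_mul, integral_const_mul,
        integral_prod _ (integrable_of_bounded hφm hφ)]
      ring
    · refine Finset.measurable_sum _ fun w _ => Measurable.const_mul (Measurable.mul ?_ ?_) _
      · exact (measurable_of_countable fun v => F v w).comp measurable_fst
      · exact (hmi w).comp measurable_snd
    · refine bounded_sum _ fun w _ => bounded_mul ⟨_, fun _ => le_rfl⟩
        (bounded_mul ⟨1, fun q => hF _ _⟩ ?_)
      obtain ⟨E, hE⟩ := hbi w
      exact ⟨E, fun q => hE _⟩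
  · simp only [pairMeasure, if_true]
    have hdiag : Measurable fun q : ℕ × X => (q, q) := by fun_prop
    rw [integral_map hdiag.aemeasurable hm2.aestronglyMeasurable,
      integral_offspringLaw K hg hm z (h := fun q => ancestorWeight true m (fun u => g (z u)) F
        q.1 q.1 * φ (q.2, q.2)) (hm2.comp hdiag) ⟨D, fun q => hD (q, q)⟩, Finset.mul_sum]
    refine Finset.sum_congr rfl fun v _ => ?_
    simp only [ancestorWeight, if_true]
    rw [integral_const_mul, Finset.sum_mul, Finset.mul_sum, Finset.mul_sum]
    refine Finset.sum_congr rfl fun w _ => ?_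
    rw [integral_map (by fun_prop) hφm.aestronglyMeasurable]
    ring

end Offspring

section PairChain

variable (M : ℕ → Kernel X X) [∀ p, IsMarkovKernel (M p)] (b : ℕ → Bool) (p : ℕ)

instance isProbabilityMeasure_pairKer (q : X × X) : IsProbabilityMeasure (pairKer M b p q) := by
  unfold pairKer
  split_ifs
  · exact Measure.isProbabilityMeasure_map (by fun_prop)
  · infer_instance

theorem measurable_pairKer : Measurable (pairKer M b p) := by
  unfold pairKer
  split_ifs
  · exact (Measure.measurable_map _ (by fun_prop)).comp ((M p).measurable.comp measurable_fst)
  · have h : Measurable fun q => (M p ∥ₖ M p) q := (M p ∥ₖ M p).measurable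
    simpa only [Kernel.parallelComp_apply] using h

/-- The two-particle Feynman–Kac operator: weight by `G p ⊗ G p`, then move by `pairKer`. -/
def pairOp (G : ℕ → X → ℝ) (φ : X × X → ℝ) (q : X × X) : ℝ :=
  G p q.1 * G p q.2 * ∫ y, φ y ∂(pairKer M b (p + 1) q)

variable {G : ℕ → X → ℝ} {φ : X × X → ℝ}

theorem measurable_pairOp (hG : Measurable (G p)) (hφ : Measurable φ) :
    Measurable (pairOp M b p G φ) := by
  let κ : Kernel (X × X) (X × X) := ⟨pairKer M b (p + 1), measurable_pairKer M b (p + 1)⟩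
  have h : Measurable fun q => ∫ y, φ y ∂(κ q) := (hφ.stronglyMeasurable.integral_kernel).measurable
  exact ((hG.comp measurable_fst).mul (hG.comp measurable_snd)).mul h

theorem bounded_pairOp (hG : ∃ C, ∀ x, |G p x| ≤ C) (hφ : ∃ C, ∀ q, |φ q| ≤ C) :
    ∃ C, ∀ q, |pairOp M b p G φ q| ≤ C := by
  obtain ⟨C, hC⟩ := hG
  exact bounded_mul (bounded_mul ⟨C, fun q => hC _⟩ ⟨C, fun q => hC _⟩) (bounded_integral hφ)

instance isProbabilityMeasure_pairInit (M0 : Measure X) [IsProbabilityMeasure M0] :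
    IsProbabilityMeasure (pairInit M0 b) := by
  unfold pairInit
  split_ifs
  · exact Measure.isProbabilityMeasure_map (by fun_prop)
  · infer_instance

theorem isProbabilityMeasure_markovPath {Y : Type*} [MeasurableSpace Y] (μ0 : Measure Y)
    [IsProbabilityMeasure μ0] {κ : ℕ → Y → Measure Y} [∀ p y, IsProbabilityMeasure (κ p y)]
    (hκ : ∀ p, Measurable (κ p)) (n : ℕ) : IsProbabilityMeasure (markovPath μ0 κ n) := by
  induction n with
  | zero => exact Measure.isProbabilityMeasure_map (by fun_prop)
  | succ n ih =>
    exact isProbabilityMeasure_bind_map (κ := fun ω : ℕ → Y => κ (n + 1) (ω n))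
      ((hκ (n + 1)).comp (measurable_pi_apply n)) measurable_update'

variable (M0 : Measure X) [IsProbabilityMeasure M0]

omit [∀ p, IsMarkovKernel (M p)] [IsProbabilityMeasure M0] in
theorem muB_zero (hφ : Measurable φ) : muB M0 M G 0 b φ = ∫ q, φ q ∂(pairInit M0 b) := by
  simp only [muB, markovPath, Finset.range_zero, Finset.prod_empty, mul_one]
  exact integral_map (by fun_prop) (hφ.comp (measurable_pi_apply 0)).aestronglyMeasurable

theorem muB_succ (n : ℕ) (hGm : ∀ q ≤ n, Measurable (G q)) (hGb : ∀ q ≤ n, ∃ C, ∀ x, |G q x| ≤ C)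
    (hφm : Measurable φ) (hφ : ∃ C, ∀ q, |φ q| ≤ C) :
    muB M0 M G (n + 1) b φ = muB M0 M G n b (pairOp M b n G φ) := by
  have := isProbabilityMeasure_markovPath (pairInit M0 b) (measurable_pairKer M b) n
  have hprod : Measurable fun ω : ℕ → X × X =>
      ∏ p ∈ Finset.range (n + 1), G p (ω p).1 * G p (ω p).2 := by
    refine Finset.measurable_prod _ fun p hp => ?_
    have := hGm p (by simpa [Nat.lt_succ_iff] using hp)
    fun_prop
  have hm : Measurable fun ω : ℕ → X × X =>
      φ (ω (n + 1)) * ∏ p ∈ Finset.range (n + 1), G p (ω p).1 * G p (ω p).2 :=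
    (hφm.comp (measurable_pi_apply _)).mul hprod
  have hb : ∃ C, ∀ ω : ℕ → X × X,
      |φ (ω (n + 1)) * ∏ p ∈ Finset.range (n + 1), G p (ω p).1 * G p (ω p).2| ≤ C := by
    obtain ⟨C, hC⟩ := hφ
    refine bounded_mul ⟨C, fun ω => hC _⟩ (bounded_prod _ fun p hp => ?_)
    obtain ⟨D, hD⟩ := hGb p (by simpa [Nat.lt_succ_iff] using hp)
    exact bounded_mul ⟨D, fun ω => hD _⟩ ⟨D, fun ω => hD _⟩
  rw [muB, markovPath, integral_bind_map (κ := fun ω : ℕ → X × X => pairKer M b (n + 1) (ω n))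
    ((measurable_pairKer M b (n + 1)).comp (measurable_pi_apply n)) measurable_update' hm hb, muB]
  refine integral_congr_ae (Eventually.of_forall fun ω => ?_)
  simp only [Function.update_self]
  have hupd (y : X × X) : ∏ p ∈ Finset.range (n + 1),
      G p (Function.update ω (n + 1) y p).1 * G p (Function.update ω (n + 1) y p).2 =
        ∏ p ∈ Finset.range (n + 1), G p (ω p).1 * G p (ω p).2 := by
    refine Finset.prod_congr rfl fun p hp => ?_
    rw [Function.update_of_ne (by have := Finset.mem_range.1 hp; omega)]
  simp only [hupd, integral_mul_const, Finset.prod_range_succ, pairOp]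
  ring

end PairChain

section ParticleFilter

theorem measurable_padF {Y : Type*} [Nonempty Y] [MeasurableSpace Y] (m : ℕ) :
    Measurable (padF : (Fin m → Y) → ℕ → Y) := by
  refine measurable_pi_iff.2 fun i => ?_
  unfold padF
  split_ifs <;> fun_prop

theorem padF_coe {Y : Type*} [Nonempty Y] {m : ℕ} (f : Fin m → Y) (i : Fin m) :
    padF f i = f i := by
  simp [padF]

variable [Nonempty X] (M0 : Measure X) [IsProbabilityMeasure M0]
  (M : ℕ → Kernel X X) [∀ p, IsMarkovKernel (M p)] {G : ℕ → X → ℝ} {Np : ℕ → ℕ}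

theorem measurable_padF_prodMk (m : ℕ) : Measurable fun f : Fin m → ℕ × X =>
    ((padF fun i => (f i).1 : ℕ → ℕ), (padF fun i => (f i).2 : ℕ → X)) :=
  ((measurable_padF m).comp (by fun_prop)).prodMk ((measurable_padF m).comp (by fun_prop))

theorem isProbabilityMeasure_pfStep (p : ℕ) (hG : ∀ x, 0 < G p x) (hN : 0 < Np p) (z : ℕ → X) :
    IsProbabilityMeasure (pfStep M G Np p z) := by
  have := isProbabilityMeasure_offspringLaw (M (p + 1)) hG hN z
  exact Measure.isProbabilityMeasure_map (μ := Measure.pi fun _ : Fin (Np (p + 1)) =>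
    offspringLaw (M (p + 1)) (G p) (Np p) z) (measurable_padF_prodMk _).aemeasurable

theorem measurable_pfStep (p : ℕ) (hG : ∀ x, 0 < G p x) (hGm : Measurable (G p)) (hN : 0 < Np p) :
    Measurable (pfStep M G Np p) := by
  have := isProbabilityMeasure_offspringLaw (M (p + 1)) hG hN
  exact (Measure.measurable_map _ (measurable_padF_prodMk _)).comp
    (measurable_pi_const (ν := offspringLaw (M (p + 1)) (G p) (Np p)) (Np (p + 1)) (measurable_offspringLaw (M (p + 1)) hGm))

/-- Append one generation to the history of the particle system. -/
def extendPath (k : ℕ) (ω : (ℕ → ℕ → X) × (ℕ → ℕ → ℕ)) (az : (ℕ → ℕ) × (ℕ → X)) :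
    (ℕ → ℕ → X) × (ℕ → ℕ → ℕ) :=
  (Function.update ω.1 (k + 1) az.2, Function.update ω.2 k az.1)

omit [Nonempty X] in
theorem measurable_extendPath (k : ℕ) :
    Measurable (Function.uncurry (extendPath (X := X) k)) := by
  refine Measurable.prodMk ?_ ?_
  · exact (measurable_update' (X := fun _ => ℕ → X) (a := k + 1)).comp
      (measurable_fst.fst.prodMk measurable_snd.snd)
  · exact (measurable_update' (X := fun _ => ℕ → ℕ) (a := k)).comp
      (measurable_fst.snd.prodMk measurable_snd.fst)

theorem isProbabilityMeasure_pfLaw (n : ℕ) (hG : ∀ q < n, ∀ x, 0 < G q x)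
    (hGm : ∀ q < n, Measurable (G q)) (hN : ∀ q < n, 0 < Np q) :
    IsProbabilityMeasure (pfLaw M0 M G Np n) := by
  induction n with
  | zero =>
    refine Measure.isProbabilityMeasure_map (Measurable.aemeasurable ?_)
    refine Measurable.prodMk (measurable_pi_iff.2 fun p => ?_) measurable_const
    split_ifs
    · exact measurable_padF _
    · exact measurable_const
  | succ n ih =>
    have := ih (fun q hq => hG q (by omega)) (fun q hq => hGm q (by omega))
      fun q hq => hN q (by omega)
    have hn := Nat.lt_succ_self n
    have := isProbabilityMeasure_pfStep M n (hG n hn) (hN n hn)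
    exact isProbabilityMeasure_bind_map
      (κ := fun ω : (ℕ → ℕ → X) × (ℕ → ℕ → ℕ) => pfStep M G Np n (ω.1 n))
      ((measurable_pfStep M n (hG n hn) (hGm n hn) (hN n hn)).comp
        ((measurable_pi_apply n).comp measurable_fst)) (measurable_extendPath n)

theorem integral_muBN_extendPath (k : ℕ) (b : ℕ → Bool) (hG : ∀ q ≤ k, ∀ x, 0 < G q x)
    (hGm : ∀ q ≤ k, Measurable (G q)) (hGb : ∀ q ≤ k, ∃ C, ∀ x, G q x ≤ C)
    (hN : ∀ q ≤ k + 1, 2 ≤ Np q) {φ : X × X → ℝ} (hφm : Measurable φ) (hφ : ∃ C, ∀ q, |φ q| ≤ C)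
    (ω : (ℕ → ℕ → X) × (ℕ → ℕ → ℕ)) :
    ∫ az, muBN G Np (k + 1) b φ (extendPath k ω az) ∂(pfStep M G Np k (ω.1 k)) =
      muBN G Np k b (pairOp M b k G φ) ω := by
  have hN0 : ∀ q ≤ k + 1, 0 < Np q := fun q hq => by have := hN q hq; omega
  have hG' : ∀ q < k + 1, ∀ x, 0 < G q x := fun q hq => hG q (by omega)
  have hGm' : ∀ q < k + 1, Measurable (G q) := fun q hq => hGm q (by omega)
  have hGk := hG k le_rfl
  have hNk := hN0 k (by omega)
  set z := ω.1 k with hz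
  set ν := offspringLaw (M (k + 1)) (G k) (Np k) z with hν
  have hνp : IsProbabilityMeasure ν := isProbabilityMeasure_offspringLaw (M (k + 1)) hGk hNk z
  set F := pairWeight G Np b ω k with hF
  have hF1 : ∀ i j, |F i j| ≤ 1 := abs_pairWeight_le_one Np b k (fun q hq => hG q hq.le) ω
  set g : (ℕ × X) × (ℕ × X) → ℝ := fun q =>
    ancestorWeight (b (k + 1)) (Np k) (fun u => G k (z u)) F q.1.1 q.2.1 * φ (q.1.2, q.2.2) with hg
  have hA : Measurable (Function.uncurry
      (ancestorWeight (b (k + 1)) (Np k) (fun u => G k (z u)) F)) := measurable_of_countable _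
  have hgm : Measurable g :=
    (hA.comp (Measurable.prodMk (f := fun q : (ℕ × X) × (ℕ × X) => q.1.1)
      (g := fun q => q.2.1) (by fun_prop) (by fun_prop))).mul (by fun_prop)
  have hgb : ∃ C, ∀ q, |g q| ≤ C := by
    obtain ⟨C, hC⟩ := hφ
    exact bounded_mul
      ⟨1, fun q => abs_ancestorWeight_le_one _ (Np k) (fun u => (hGk _).le) hF1 _ _⟩
      ⟨C, fun q => hC _⟩
  have heta (az : (ℕ → ℕ) × (ℕ → X)) : ∏ p ∈ Finset.range (k + 1),
      etaN Np p (G p) (extendPath k ω az) = ∏ p ∈ Finset.range (k + 1), etaN Np p (G p) ω := by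
    refine Finset.prod_congr rfl fun p hp => ?_
    have : p ≠ k + 1 := by have := Finset.mem_range.1 hp; omega
    simp only [etaN, extendPath, Function.update_of_ne this]
  have hpw (az : (ℕ → ℕ) × (ℕ → X)) : pairWeight G Np b (extendPath k ω az) k = F := by
    refine pairWeight_congr G Np b k fun q hq => ?_
    simp [extendPath, Function.update_of_ne (show q ≠ k + 1 by omega),
      Function.update_of_ne hq.ne]
  have hval (f : Fin (Np (k + 1)) → ℕ × X) :
      muBN G Np (k + 1) b φ (extendPath k ω (padF fun i => (f i).1, padF fun i => (f i).2)) =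
        (∏ p ∈ Finset.range (k + 2), pairConst Np b p) *
          (∏ p ∈ Finset.range (k + 1), etaN Np p (G p) ω) ^ 2 * ((Np (k + 1) : ℝ) ^ 2)⁻¹ *
          ∑ i, ∑ j, if (i = j ↔ b (k + 1) = true) then g (f i, f j) else 0 := by
    rw [muBN_eq (k + 1) b hG' hN0 hφ, heta, Finset.sum_range]
    congr 1
    refine Finset.sum_congr rfl fun i _ => ?_
    rw [Finset.sum_range]
    refine Finset.sum_congr rfl fun j _ => ?_
    rw [pairWeight, hpw]
    have hk : k ≠ k + 1 := by omega
    simp only [extendPath, Function.update_self, Function.update_of_ne hk, padF_coe, i.2, j.2,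
      true_and, Fin.val_inj, ite_mul, zero_mul, hg, hz]
  have hstep : ∫ az, muBN G Np (k + 1) b φ (extendPath k ω az) ∂(pfStep M G Np k z) =
      ∫ f, muBN G Np (k + 1) b φ (extendPath k ω (padF fun i => (f i).1, padF fun i => (f i).2))
        ∂(Measure.pi fun _ : Fin (Np (k + 1)) => ν) :=
    integral_map (measurable_padF_prodMk _).aemeasurable
      ((measurable_muBN (k + 1) b hG' hGm' hN0 hφm hφ).comp
        (measurable_extendPath k).of_uncurry_left).aestronglyMeasurable
  have hsum := integral_pi_sum_pairs (hN (k + 1) le_rfl) (b (k + 1)) ν hgm hgb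
  have hpair := integral_pairMeasure_offspringLaw (M (k + 1)) hGk hNk (b (k + 1)) z hF1 hφm hφ
  have hS : 0 < ∑ u ∈ Finset.range (Np k), G k (z u) :=
    Finset.sum_pos (fun u _ => hGk _) ⟨0, Finset.mem_range.2 hNk⟩
  have hGb' : ∃ C, ∀ x, |G k x| ≤ C := exists_abs_le_of_pos hGk (hGb k le_rfl)
  rw [hstep]
  simp only [hval, integral_const_mul]
  rw [muBN_eq k b (fun q hq => hG q hq.le) (fun q hq => hN0 q (by omega))
    (bounded_pairOp M b k hGb' hφ), Finset.prod_range_succ _ (k + 1),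
    Finset.prod_range_succ (fun p => etaN Np p (G p) ω) k]
  have hNk' : (Np k : ℝ) ≠ 0 := by exact_mod_cast hNk.ne'
  have hetak : etaN Np k (G k) ω = (Np k : ℝ)⁻¹ * ∑ u ∈ Finset.range (Np k), G k (z u) := rfl
  have hrhs : ∑ i ∈ Finset.range (Np k), ∑ j ∈ Finset.range (Np k),
      pairWeight G Np b ω k i j * pairOp M b k G φ (ω.1 k i, ω.1 k j) =
        (∑ u ∈ Finset.range (Np k), G k (z u)) ^ 2 * ∫ q, g q ∂(pairMeasure (b (k + 1)) ν) := by
    rw [hg, hν, hpair, ← mul_assoc, ← mul_pow, mul_inv_cancel₀ hS.ne', one_pow, one_mul]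
    rfl
  rw [hrhs, ← hsum, hetak]
  simp only [pairConst]
  field_simp

end ParticleFilter

theorem integral_muBN_zero [Nonempty X] (M0 : Measure X) [IsProbabilityMeasure M0]
    (M : ℕ → Kernel X X) {G : ℕ → X → ℝ} {Np : ℕ → ℕ} (hN : 2 ≤ Np 0) (b : ℕ → Bool)
    {φ : X × X → ℝ} (hφm : Measurable φ) (hφ : ∃ C, ∀ q, |φ q| ≤ C) :
    ∫ ω, muBN G Np 0 b φ ω ∂(pfLaw M0 M G Np 0) = ∫ q, φ q ∂(pairInit M0 b) := by
  have hN0 : ∀ q ≤ 0, 0 < Np q := fun q hq => by obtain rfl := Nat.le_zero.1 hq; omega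
  have hm : Measurable fun f : Fin (Np 0) → X =>
      ((fun p => if p = 0 then padF f else fun _ => Classical.arbitrary X, fun _ _ => 0) :
        (ℕ → ℕ → X) × (ℕ → ℕ → ℕ)) := by
    refine Measurable.prodMk (measurable_pi_iff.2 fun p => ?_) measurable_const
    split_ifs
    · exact measurable_padF _
    · exact measurable_const
  rw [pfLaw, integral_map hm.aemeasurable
    (measurable_muBN 0 b (by simp) (by simp) hN0 hφm hφ).aestronglyMeasurable]
  have hval (f : Fin (Np 0) → X) : muBN G Np 0 b φ
      ((fun p => if p = 0 then padF f else fun _ => Classical.arbitrary X, fun _ _ => 0)) =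
        pairConst Np b 0 * ((Np 0 : ℝ) ^ 2)⁻¹ *
          ∑ i, ∑ j, if (i = j ↔ b 0 = true) then φ (f i, f j) else 0 := by
    rw [muBN_eq 0 b (by simp) hN0 hφ, Finset.sum_range]
    simp only [zero_add, Finset.prod_range_one, Finset.range_zero, Finset.prod_empty, one_pow,
      mul_one]
    congr 1
    refine Finset.sum_congr rfl fun i _ => ?_
    rw [Finset.sum_range]
    refine Finset.sum_congr rfl fun j _ => ?_
    simp only [pairWeight, if_true, padF_coe, i.2, j.2, true_and, Fin.val_inj, ite_mul, one_mul,
      zero_mul]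
  simp only [hval, integral_const_mul]
  exact integral_pi_sum_pairs hN (b 0) M0 hφm hφ

theorem integral_muBN [Nonempty X] (M0 : Measure X) [IsProbabilityMeasure M0]
    (M : ℕ → Kernel X X) [∀ p, IsMarkovKernel (M p)] {G : ℕ → X → ℝ} {Np : ℕ → ℕ} (n : ℕ)
    (b : ℕ → Bool) (hG : ∀ q ≤ n, ∀ x, 0 < G q x) (hGm : ∀ q ≤ n, Measurable (G q))
    (hGb : ∀ q ≤ n, ∃ C, ∀ x, G q x ≤ C) (hN : ∀ q ≤ n, 2 ≤ Np q)
    {φ : X × X → ℝ} (hφm : Measurable φ) (hφ : ∃ C, ∀ q, |φ q| ≤ C) :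
    ∫ ω, muBN G Np n b φ ω ∂(pfLaw M0 M G Np n) = muB M0 M G n b φ := by
  induction n generalizing φ with
  | zero => rw [integral_muBN_zero M0 M (hN 0 le_rfl) b hφm hφ, muB_zero M b M0 hφm]
  | succ n ih =>
    have hG' : ∀ q ≤ n, ∀ x, 0 < G q x := fun q hq => hG q (by omega)
    have hGm' : ∀ q ≤ n, Measurable (G q) := fun q hq => hGm q (by omega)
    have hGb' : ∀ q ≤ n, ∃ C, ∀ x, G q x ≤ C := fun q hq => hGb q (by omega)
    have hGabs : ∀ q ≤ n, ∃ C, ∀ x, |G q x| ≤ C := fun q hq =>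
      exists_abs_le_of_pos (hG' q hq) (hGb' q hq)
    have hN0 : ∀ q ≤ n + 1, 0 < Np q := fun q hq => by have := hN q hq; omega
    have := isProbabilityMeasure_pfLaw M0 M n (fun q hq => hG q (by omega))
      (fun q hq => hGm q (by omega)) fun q hq => hN0 q (by omega)
    have := isProbabilityMeasure_pfStep M n (hG' n le_rfl) (hN0 n (by omega))
    have hstep : Measurable fun ω : (ℕ → ℕ → X) × (ℕ → ℕ → ℕ) => pfStep M G Np n (ω.1 n) :=
      (measurable_pfStep M n (hG' n le_rfl) (hGm' n le_rfl) (hN0 n (by omega))).comp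
        ((measurable_pi_apply n).comp measurable_fst)
    have hbind := integral_bind_map (μ := pfLaw M0 M G Np n) hstep (measurable_extendPath n)
      (measurable_muBN (n + 1) b (fun q hq => hG q hq.le) (fun q hq => hGm q hq.le) hN0 hφm hφ)
      (bounded_muBN (n + 1) b (fun q hq => hG q hq.le) (fun q hq => hGb q hq.le) hN0 hφ)
    rw [muB_succ M b M0 n hGm' hGabs hφm hφ, ← ih hG' hGm' hGb' (fun q hq => hN q (by omega))
      (measurable_pairOp M b n (hGm' n le_rfl) hφm) (bounded_pairOp M b n (hGabs n le_rfl) hφ)]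
    simp only [integral_muBN_extendPath M n b hG' hGm' hGb' hN hφm hφ] at hbind
    exact hbind

open PFVar MeasureTheory ProbabilityTheory Filter

theorem statement12
    {X : Type*} [MeasurableSpace X] [Nonempty X] (hX : ∃ x y : X, x ≠ y) (n : ℕ)
    (M0 : Measure X) [IsProbabilityMeasure M0]
    (M : ℕ → Kernel X X) [∀ p, IsMarkovKernel (M p)]
    (G : ℕ → X → ℝ) (hGm : ∀ p ≤ n, Measurable (G p))
    (hGpos : ∀ p ≤ n, ∀ x, 0 < G p x) (hGbd : ∀ p ≤ n, ∃ C, ∀ x, G p x ≤ C)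
    (c : ℕ → ℝ) (hc : ∀ p ≤ n, 0 < c p)
    (b : Fin (n + 1) → Bool)
    (φ : X × X → ℝ) (hφm : Measurable φ) (hφb : ∃ C, ∀ q, |φ q| ≤ C) :
    ∀ N : ℕ, 1 ≤ N → (∀ p ≤ n, 2 ≤ npart c N p) →
      ∫ ω, muBN G (npart c N) n (extB n b) φ ω ∂(pfLaw M0 M G (npart c N) n)
        = muB M0 M G n (extB n b) φ := by
  intro N _ hN
  exact integral_muBN M0 M n (extB n b) hGpos hGm hGbd hN hφm hφb
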